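/- Let 𝕏 be a standard Gaussian random vector on ℝ^D (D ≥ 1) with density f, and let ri(z) := P(f(𝕏) ≤ f(z)) be the associated realisticity index. Then ri(z) is a strictly decreasing function of ‖z‖: for all z₁, z₂ ∈ ℝ^D with ‖z₁‖ < ‖z₂‖, one has ri(z₂) < ri(z₁). -/

import Mathlib

open MeasureTheory

/-- The function `v ↦ exp (-‖v‖² / 2)` is integrable on a finite-dimensional inner product
space. -/
theorem integrable_exp_neg_sq_norm_div_two {V : Type*} [NormedAddCommGroup V]
    [InnerProductSpace ℝ V] [FiniteDimensional ℝ V] [MeasurableSpace V] [BorelSpace V] :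
    Integrable (fun v : V => Real.exp (-‖v‖ ^ 2 / 2)) := by
  have h := GaussianFourier.integrable_cexp_neg_mul_sq_norm_add (V := V) (b := 1 / 2)
    (by norm_num) 0 0
  refine h.norm.congr (Filter.Eventually.of_forall fun v => ?_)
  simp only [Complex.norm_exp]
  congr 1
  have : (-(1 / 2) * (‖v‖ : ℂ) ^ 2 + 0 * (inner ℝ (0 : V) v : ℝ) : ℂ)
      = ((-‖v‖ ^ 2 / 2 : ℝ) : ℂ) := by
    push_cast
    ring
  rw [this, Complex.ofReal_re]

/-- For a finite measure charging all nonempty open sets, sublevel sets of a continuous function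
on a preconnected space have strictly increasing measure between two attained values. -/
theorem measure_sublevel_lt_of_lt {X : Type*} [TopologicalSpace X] [PreconnectedSpace X]
    [MeasurableSpace X] [OpensMeasurableSpace X] (μ : Measure X) [IsFiniteMeasure μ]
    [μ.IsOpenPosMeasure] {f : X → ℝ} (hf : Continuous f) {x y : X} (hxy : f x < f y) :
    μ {w | f w ≤ f x} < μ {w | f w ≤ f y} := by
  have hopen : IsOpen (f ⁻¹' Set.Ioo (f x) (f y)) := isOpen_Ioo.preimage hf
  obtain ⟨c, hxc, hcy⟩ := exists_between hxy
  obtain ⟨w, rfl⟩ := mem_range_of_exists_le_of_exists_ge hf ⟨x, hxc.le⟩ ⟨y, hcy.le⟩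
  have hpos := hopen.measure_pos μ ⟨w, hxc, hcy⟩
  calc μ {w | f w ≤ f x}
      < μ {w | f w ≤ f x} + μ (f ⁻¹' Set.Ioo (f x) (f y)) :=
        ENNReal.lt_add_right (measure_ne_top _ _) hpos.ne'
    _ = μ ({w | f w ≤ f x} ∪ f ⁻¹' Set.Ioo (f x) (f y)) :=
        (measure_union (Set.disjoint_left.2 fun w hw hw' => hw'.1.not_ge hw)
          hopen.measurableSet).symm
    _ ≤ μ {w | f w ≤ f y} :=
        measure_mono (Set.union_subset (fun w hw => le_trans hw hxy.le) fun w hw => hw.2.le)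

/-- For a standard Gaussian random vector `𝕏` on `ℝ^D` (`D ≥ 1`) with density
`f` (distribution `μ`), the realisticity index `ri(z) = P(f(𝕏) ≤ f(z))` is strictly
decreasing in `‖z‖`: if `‖z₁‖ < ‖z₂‖` then `ri(z₂) < ri(z₁)`. -/
theorem gaussian_realisticity_index_strictAnti_in_norm
    {D : ℕ} (hD : 1 ≤ D)
    (f : EuclideanSpace ℝ (Fin D) → ℝ)
    (hf : f = fun z => (2 * Real.pi) ^ (-(D : ℝ) / 2) * Real.exp (-‖z‖ ^ 2 / 2))
    (μ : Measure (EuclideanSpace ℝ (Fin D)))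
    (hμ : μ = (volume : Measure (EuclideanSpace ℝ (Fin D))).withDensity
      (fun x => ENNReal.ofReal (f x))) :
    ∀ z₁ z₂ : EuclideanSpace ℝ (Fin D), ‖z₁‖ < ‖z₂‖ →
      μ {w | f w ≤ f z₂} < μ {w | f w ≤ f z₁} := by
  intro z₁ z₂ hz
  have hcont : Continuous f := by rw [hf]; fun_prop
  have hfpos : ∀ x, 0 < f x := fun x => by rw [hf]; positivity
  have hint : Integrable f := by
    rw [hf]
    exact integrable_exp_neg_sq_norm_div_two.const_mul _
  have hfin : IsFiniteMeasure μ := hμ ▸ isFiniteMeasure_withDensity_ofReal hint.2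
  have hac : (volume : Measure (EuclideanSpace ℝ (Fin D))) ≪ μ := by
    rw [hμ]
    exact withDensity_absolutelyContinuous' (by fun_prop)
      (Filter.Eventually.of_forall fun x => (ENNReal.ofReal_pos.2 (hfpos x)).ne')
  have hpos : μ.IsOpenPosMeasure := hac.isOpenPosMeasure
  refine measure_sublevel_lt_of_lt μ hcont ?_
  have hsq : ‖z₁‖ ^ 2 < ‖z₂‖ ^ 2 := by gcongr
  rw [hf]
  dsimp only
  gcongr
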